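/- Suppose X₀ has a smooth density ρ₀ and set L := sup_x ‖∇² log ρ₀(x)‖ < ∞ (operator norm). Then for every t with 0 < t ≤ min{1/2, 1/(2(L+1)), 1/(2Ld)}, one has sup_x ‖∇² log ρ_t(x)‖ ≤ 4L. -/

import Mathlib

open MeasureTheory Real Filter
open scoped ENNReal

noncomputable section

/-- Density at `x` of the Gaussian distribution `N(√(1-t)·x₀, t·I_d)`, i.e. the transition
density of `X_t = √(1-t)·X₀ + √t·Z` given `X₀ = x₀`. -/
def heatKernel (d : ℕ) (t : ℝ) (x x₀ : EuclideanSpace ℝ (Fin d)) : ℝ :=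
  (2 * π * t) ^ (-(d : ℝ) / 2) * Real.exp (-‖x - Real.sqrt (1 - t) • x₀‖ ^ 2 / (2 * t))

/-- The density `ρ_t` of `X_t = √(1-t)·X₀ + √t·Z` where `X₀ ∼ μ` and `Z ∼ N(0, I_d)`
is independent of `X₀`. -/
def rho (d : ℕ) (μ : Measure (EuclideanSpace ℝ (Fin d))) (t : ℝ)
    (x : EuclideanSpace ℝ (Fin d)) : ℝ :=
  ∫ x₀, heatKernel d t x x₀ ∂μ

/-- Density of the standard Gaussian `N(0, I_d)` on `ℝ^d`. -/
def stdGaussianDensity (d : ℕ) (z : EuclideanSpace ℝ (Fin d)) : ℝ :=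
  (2 * π) ^ (-(d : ℝ) / 2) * Real.exp (-‖z‖ ^ 2 / 2)

/-- Conditional expectation `E[f(X_t) | X₀ = x₀] = E_{Z ∼ N(0,I_d)}[f(√(1-t)·x₀ + √t·Z)]`. -/
def condExpX0 (d : ℕ) (t : ℝ) (x₀ : EuclideanSpace ℝ (Fin d))
    (f : EuclideanSpace ℝ (Fin d) → ℝ) : ℝ :=
  ∫ z, f (Real.sqrt (1 - t) • x₀ + Real.sqrt t • z) * stdGaussianDensity d z

section core
variable {d : ℕ}

lemma aux_intg (W : EuclideanSpace ℝ (Fin d) → ℝ) (hWpos : ∀ z, 0 < W z)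
    (hWc : Continuous W) (hW0 : Integrable W) (hW2 : Integrable (fun z => ‖z‖ ^ 2 * W z))
    (f : EuclideanSpace ℝ (Fin d) → ℝ) (hf : Continuous f) (C : ℝ)
    (hC : ∀ z, |f z| ≤ C * (1 + ‖z‖ ^ 2)) : Integrable (fun z => f z * W z) := by
  refine Integrable.mono' ((hW0.add hW2).const_mul C) (by fun_prop) ?_
  refine Eventually.of_forall fun z => ?_
  rw [norm_mul, Real.norm_eq_abs, Real.norm_eq_abs, abs_of_pos (hWpos z)]
  calc |f z| * W z ≤ C * (1 + ‖z‖ ^ 2) * W z :=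
        mul_le_mul_of_nonneg_right (hC z) (hWpos z).le
    _ = _ := by simp only [Pi.add_apply]; ring

lemma aux_intg2 (W : EuclideanSpace ℝ (Fin d) → ℝ) (hWpos : ∀ z, 0 < W z)
    (hWc : Continuous W) (hW0 : Integrable W) (hW2 : Integrable (fun z => ‖z‖ ^ 2 * W z))
    (f h : EuclideanSpace ℝ (Fin d) → ℝ) (hf : Continuous f) (hh : Continuous h) (A B : ℝ)
    (hA : ∀ z, |f z| ≤ A * (1 + ‖z‖)) (hB : ∀ z, |h z| ≤ B * (1 + ‖z‖)) :
    Integrable (fun z => f z * h z * W z) := by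
  refine aux_intg W hWpos hWc hW0 hW2 (fun z => f z * h z) (by fun_prop) (A * B * 2) fun z => ?_
  rw [abs_mul]
  have hA0 : 0 ≤ A := by
    have := (abs_nonneg _).trans (hA 0); simpa using this
  have hB0 : 0 ≤ B := by
    have := (abs_nonneg _).trans (hB 0); simpa using this
  calc |f z| * |h z| ≤ (A * (1 + ‖z‖)) * (B * (1 + ‖z‖)) :=
        mul_le_mul (hA z) (hB z) (abs_nonneg _) ((abs_nonneg _).trans (hA z))
    _ = A * B * (1 + ‖z‖) ^ 2 := by ring
    _ ≤ A * B * (2 * (1 + ‖z‖ ^ 2)) := by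
        refine mul_le_mul_of_nonneg_left ?_ (mul_nonneg hA0 hB0)
        nlinarith [sq_nonneg (1 - ‖z‖)]
    _ = _ := by ring

lemma aux_ibp (W : EuclideanSpace ℝ (Fin d) → ℝ) (hWpos : ∀ z, 0 < W z)
    (hWc : Continuous W) (hW0 : Integrable W) (hW2 : Integrable (fun z => ‖z‖ ^ 2 * W z))
    (Q : EuclideanSpace ℝ (Fin d) → EuclideanSpace ℝ (Fin d)) (hQ : Continuous Q) (C : ℝ)
    (hC : ∀ z, ‖Q z‖ ≤ C * (1 + ‖z‖))
    (hWd : ∀ z, HasFDerivAt W (W z • innerSL ℝ (Q z)) z)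
    (h : EuclideanSpace ℝ (Fin d) → ℝ)
    (h' : EuclideanSpace ℝ (Fin d) → EuclideanSpace ℝ (Fin d) →L[ℝ] ℝ)
    (hd : ∀ z, HasFDerivAt h (h' z) z) (hh' : Continuous h') (A B : ℝ)
    (hA : ∀ z, |h z| ≤ A * (1 + ‖z‖)) (v : EuclideanSpace ℝ (Fin d)) (hB : ∀ z, |h' z v| ≤ B) :
    ∫ z, h z * inner ℝ (Q z) v * W z = - ∫ z, h' z v * W z := by
  have hc : Continuous h := continuous_iff_continuousAt.2 fun z => (hd z).continuousAt
  have hB0 : 0 ≤ B := (abs_nonneg _).trans (hB 0)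
  have hA0 : 0 ≤ A := by
    have := (abs_nonneg _).trans (hA 0); simpa using this
  have key := integral_bilinear_hasFDerivAt_right_eq_neg_left_of_integrable
    (μ := (volume : Measure (EuclideanSpace ℝ (Fin d))))
    (f := h) (f' := h') (g := W) (g' := fun z => W z • innerSL ℝ (Q z)) (v := v)
    (B := ContinuousLinearMap.mul ℝ ℝ) ?_ ?_ ?_ (fun z _ => hd z) (fun z _ => hWd z)
  · simp only [ContinuousLinearMap.mul_apply', smul_apply,
      innerSL_apply_apply, smul_eq_mul] at key
    rw [← key]
    congr 1; ext z; ring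
  · simp only [ContinuousLinearMap.mul_apply']
    refine aux_intg W hWpos hWc hW0 hW2 (fun z => h' z v) (by fun_prop) B fun z => ?_
    refine (hB z).trans ?_
    nlinarith [sq_nonneg ‖z‖]
  · simp only [ContinuousLinearMap.mul_apply', smul_apply,
      innerSL_apply_apply, smul_eq_mul]
    have := aux_intg2 W hWpos hWc hW0 hW2 h (fun z => inner ℝ (Q z) v) hc (by fun_prop) A
      (C * ‖v‖) hA (fun z => by
        refine (abs_real_inner_le_norm _ _).trans ?_
        nlinarith [hC z, norm_nonneg v])
    refine this.congr (Eventually.of_forall fun z => ?_)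
    simp only; ring
  · simp only [ContinuousLinearMap.mul_apply']
    refine aux_intg W hWpos hWc hW0 hW2 h hc (A * 2) fun z => ?_
    refine (hA z).trans ?_
    have : 1 + ‖z‖ ≤ 2 * (1 + ‖z‖ ^ 2) := by nlinarith [sq_nonneg (1 - ‖z‖)]
    nlinarith

lemma aux_core (W : EuclideanSpace ℝ (Fin d) → ℝ) (hWpos : ∀ z, 0 < W z)
    (hWc : Continuous W) (hW0 : Integrable W) (hW2 : Integrable (fun z => ‖z‖ ^ 2 * W z))
    (hW1 : ∫ z, W z = 1) (L κ : ℝ) (hκ : L < κ)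
    (p : EuclideanSpace ℝ (Fin d))
    (G : EuclideanSpace ℝ (Fin d) → EuclideanSpace ℝ (Fin d))
    (hG : ContDiff ℝ 1 G) (hGL : ∀ z, ‖fderiv ℝ G z‖ ≤ L)
    (hWd : ∀ z, HasFDerivAt W (W z • innerSL ℝ ((p - κ • z) + G z)) z)
    (u v : EuclideanSpace ℝ (Fin d)) (hu : ‖u‖ = 1) (hv : ‖v‖ = 1) :
    |(∫ z, inner ℝ (p - κ • z) u * inner ℝ (p - κ • z) v * W z) - κ * inner ℝ u v
      - (∫ z, inner ℝ (p - κ • z) u * W z) * (∫ z, inner ℝ (p - κ • z) v * W z)|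
      ≤ L + L ^ 2 * (d / (κ - L)) := by
  have hGd : Differentiable ℝ G := hG.differentiable (by norm_num)
  have hGc : Continuous G := hG.continuous
  have hG'c : Continuous (fderiv ℝ G) := hG.continuous_fderiv (by norm_num)
  have hL0 : 0 ≤ L := (norm_nonneg _).trans (hGL 0)
  have hlip : ∀ y z, ‖G y - G z‖ ≤ L * ‖y - z‖ := fun y z =>
    Convex.norm_image_sub_le_of_norm_fderiv_le (s := Set.univ) (fun x _ => hGd x)
      (fun x _ => hGL x) convex_univ (Set.mem_univ _) (Set.mem_univ _)
  set S : EuclideanSpace ℝ (Fin d) → EuclideanSpace ℝ (Fin d) := fun z => p - κ • z with hS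
  have hSc : Continuous S := by fun_prop
  -- growth
  obtain ⟨CS, hCS⟩ : ∃ C, ∀ z, ‖S z‖ ≤ C * (1 + ‖z‖) := by
    refine ⟨‖p‖ + |κ|, fun z => ?_⟩
    refine (norm_sub_le _ _).trans ?_
    rw [norm_smul, Real.norm_eq_abs]
    nlinarith [norm_nonneg p, abs_nonneg κ, norm_nonneg z, mul_nonneg (norm_nonneg p) (norm_nonneg z)]
  obtain ⟨CG, hCG⟩ : ∃ C, ∀ z, ‖G z‖ ≤ C * (1 + ‖z‖) := by
    refine ⟨‖G 0‖ + L, fun z => ?_⟩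
    have h1 := hlip z 0
    have h2 : ‖G z‖ ≤ ‖G z - G 0‖ + ‖G 0‖ := by simpa using norm_add_le (G z - G 0) (G 0)
    rw [sub_zero] at h1
    nlinarith [norm_nonneg (G 0), norm_nonneg z, mul_nonneg (norm_nonneg (G 0)) (norm_nonneg z)]
  have hCQ : ∀ z, ‖S z + G z‖ ≤ (CS + CG) * (1 + ‖z‖) := fun z => by
    refine (norm_add_le _ _).trans ?_
    have := hCS z; have := hCG z; linarith
  have gin : ∀ (F : EuclideanSpace ℝ (Fin d) → EuclideanSpace ℝ (Fin d)) (C : ℝ),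
      (∀ z, ‖F z‖ ≤ C * (1 + ‖z‖)) → ∀ w z, |inner ℝ (F z) w| ≤ (C * ‖w‖) * (1 + ‖z‖) := by
    intro F C hF w z
    refine (abs_real_inner_le_norm _ _).trans ?_
    nlinarith [hF z, norm_nonneg w]
  have I2 : ∀ (f h : EuclideanSpace ℝ (Fin d) → ℝ) (A B : ℝ), Continuous f → Continuous h →
      (∀ z, |f z| ≤ A * (1 + ‖z‖)) → (∀ z, |h z| ≤ B * (1 + ‖z‖)) →
      Integrable (fun z => f z * h z * W z) := fun f h A B hf hh hA hB =>
    aux_intg2 W hWpos hWc hW0 hW2 f h hf hh A B hA hB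
  have I1 : ∀ (f : EuclideanSpace ℝ (Fin d) → ℝ) (A : ℝ), Continuous f →
      (∀ z, |f z| ≤ A * (1 + ‖z‖)) → Integrable (fun z => f z * W z) := fun f A hf hA => by
    have := I2 f (fun _ => 1) A 1 hf continuous_const hA (fun z => by
      simp)
    simpa using this
  have Is : ∀ w, Integrable (fun z => inner ℝ (S z) w * W z) := fun w =>
    I1 _ _ (by fun_prop) (gin S CS hCS w)
  have Ig : ∀ w, Integrable (fun z => inner ℝ (G z) w * W z) := fun w =>
    I1 _ _ (by fun_prop) (gin G CG hCG w)
  have Iss : ∀ w w', Integrable (fun z => inner ℝ (S z) w * inner ℝ (S z) w' * W z) := fun w w' =>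
    I2 _ _ _ _ (by fun_prop) (by fun_prop) (gin S CS hCS w) (gin S CS hCS w')
  have Isg : ∀ w w', Integrable (fun z => inner ℝ (S z) w * inner ℝ (G z) w' * W z) := fun w w' =>
    I2 _ _ _ _ (by fun_prop) (by fun_prop) (gin S CS hCS w) (gin G CG hCG w')
  have Igg : ∀ w w', Integrable (fun z => inner ℝ (G z) w * inner ℝ (G z) w' * W z) := fun w w' =>
    I2 _ _ _ _ (by fun_prop) (by fun_prop) (gin G CG hCG w) (gin G CG hCG w')
  have ibp := aux_ibp W hWpos hWc hW0 hW2 (fun z => S z + G z) (by fun_prop) (CS + CG) hCQ hWd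
  -- (1)
  have E1 : ∀ w, ∫ z, inner ℝ (S z) w * W z = - ∫ z, inner ℝ (G z) w * W z := by
    intro w
    have := ibp (fun _ => 1) (fun _ => 0) (fun z => hasFDerivAt_const _ _) continuous_const 1 0
      (fun z => by simp) w (fun z => by simp)
    simp only [one_mul, inner_add_left, add_mul, zero_apply, zero_mul,
      integral_zero, neg_zero] at this
    rw [integral_add (Is w) (Ig w)] at this
    linarith
  -- (2)
  have E2 : ∫ z, inner ℝ (S z) u * inner ℝ (S z) v * W z =
      κ * inner ℝ u v - ∫ z, inner ℝ (S z) u * inner ℝ (G z) v * W z := by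
    have := ibp (fun z => inner ℝ (S z) u) (fun _ => (-κ) • innerSL ℝ u)
      (fun z => by
        have h1 : HasFDerivAt (fun z => inner ℝ u p - κ * inner ℝ u z) ((-κ) • innerSL ℝ u) z := by
          have h2 := ((innerSL ℝ u).hasFDerivAt (x := z)).const_mul κ
          have h3 := h2.const_sub (inner ℝ u p)
          rw [neg_smul]
          exact h3
        convert! h1 using 1
        ext z
        simp [hS, inner_sub_left, inner_smul_left, real_inner_comm]) continuous_const
      _ (|κ * inner ℝ u v|) (gin S CS hCS u) v (fun z => by simp)
    simp only [inner_add_left, mul_add, add_mul, smul_apply,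
      innerSL_apply_apply, smul_eq_mul] at this
    rw [integral_add (Iss u v) (Isg u v), integral_const_mul, hW1] at this
    linarith
  -- (3)
  have hbd : ∀ z, |inner ℝ (fderiv ℝ G z u) v| ≤ L := fun z => by
    refine (abs_real_inner_le_norm _ _).trans ?_
    rw [hv, mul_one]
    refine ((fderiv ℝ G z).le_opNorm u).trans ?_
    rw [hu, mul_one]; exact hGL z
  have E3 : ∫ z, inner ℝ (S z) u * inner ℝ (G z) v * W z =
      - (∫ z, inner ℝ (fderiv ℝ G z u) v * W z) - ∫ z, inner ℝ (G z) u * inner ℝ (G z) v * W z := by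
    have := ibp (fun z => inner ℝ (G z) v) (fun z => (innerSL ℝ v).comp (fderiv ℝ G z))
      (fun z => by
        have h1 := ((innerSL ℝ v).hasFDerivAt (x := G z)).comp z (hGd z).hasFDerivAt
        convert! h1 using 1
        ext z
        simp [real_inner_comm]) (by fun_prop)
      _ L (gin G CG hCG v) u (fun z => by
        simpa [real_inner_comm] using hbd z)
    simp only [inner_add_left, mul_add, add_mul, ContinuousLinearMap.comp_apply,
      innerSL_apply_apply] at this
    simp only [mul_comm (inner ℝ (G _) v)] at this
    simp only [real_inner_comm _ v] at this
    rw [integral_add (Isg u v) (Igg u v)] at this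
    linarith
  -- (4)
  have Iz : Integrable (fun z => W z • z) := by
    refine Integrable.mono' (hW0.add hW2) (by fun_prop) (Eventually.of_forall fun z => ?_)
    rw [norm_smul, Real.norm_eq_abs, abs_of_pos (hWpos z)]
    simp only [Pi.add_apply]
    nlinarith [hWpos z, mul_nonneg (hWpos z).le (sq_nonneg (1 - ‖z‖)), mul_nonneg (hWpos z).le (norm_nonneg z)]
  set m : EuclideanSpace ℝ (Fin d) := ∫ z, W z • z with hm
  have hm0 : ∀ c, ∫ z, inner ℝ c (z - m) * W z = 0 := by
    intro c
    have h1 : ∫ z, inner ℝ c (W z • z) = inner ℝ c m := integral_inner Iz c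
    have h2 : (fun z => inner ℝ c (z - m) * W z) = fun z => inner ℝ c (W z • z) - inner ℝ c m * W z := by
      ext z; rw [inner_sub_right, inner_smul_right]; ring
    rw [h2, integral_sub (Iz.const_inner c) (hW0.const_mul _), h1, integral_const_mul, hW1]
    ring
  have hCm : ∀ z, ‖z - m‖ ≤ (1 + ‖m‖) * (1 + ‖z‖) := fun z => by
    refine (norm_sub_le _ _).trans ?_
    nlinarith [norm_nonneg m, norm_nonneg z, mul_nonneg (norm_nonneg m) (norm_nonneg z)]
  have Imm : Integrable (fun z => ‖z - m‖ ^ 2 * W z) := by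
    have := I2 (fun z => ‖z - m‖) (fun z => ‖z - m‖) _ _ (by fun_prop) (by fun_prop)
      (fun z => by rw [abs_of_nonneg (norm_nonneg _)]; exact hCm z)
      (fun z => by rw [abs_of_nonneg (norm_nonneg _)]; exact hCm z)
    simpa [pow_two] using this
  have E4 : ∀ w, ‖w‖ = 1 → ∫ z, inner ℝ (S z + G z) w * inner ℝ w (z - m) * W z = -1 := by
    intro w hw
    have := ibp (fun z => inner ℝ w (z - m)) (fun _ => innerSL ℝ w)
      (fun z => by
        have h1 := ((innerSL ℝ w).hasFDerivAt (x := z)).sub_const (inner ℝ w m)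
        convert! h1 using 1
        ext z
        simp [inner_sub_right]) continuous_const
      _ 1 (fun z => by
        have := gin (fun z => z - m) (1 + ‖m‖) hCm w z
        rwa [real_inner_comm] at this) w (fun z => by simp [hw])
    simp only [innerSL_apply_apply, real_inner_self_eq_norm_sq, hw, one_pow, one_mul, hW1] at this
    rw [← this]
    congr 1; ext z; ring
  have Itr : ∀ w, Integrable (fun z => inner ℝ (S z + G z) w * inner ℝ w (z - m) * W z) := fun w =>
    I2 _ _ _ _ (by fun_prop) (by fun_prop) (gin (fun z => S z + G z) _ hCQ w) (fun z => by
        have := gin (fun z => z - m) (1 + ‖m‖) hCm w z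
        rwa [real_inner_comm] at this)
  have b := EuclideanSpace.basisFun (Fin d) ℝ
  have E5 : ∫ z, inner ℝ (S z + G z) (z - m) * W z = -d := by
    have h1 : (fun z => inner ℝ (S z + G z) (z - m) * W z) =
        fun z => ∑ i, inner ℝ (S z + G z) (b i) * inner ℝ (b i) (z - m) * W z := by
      ext z
      rw [← b.sum_inner_mul_inner, Finset.sum_mul]
    rw [h1, integral_finsetSum _ (fun i _ => Itr (b i))]
    simp [E4 _ (b.norm_eq_one _)]
  have I5 : Integrable (fun z => inner ℝ (S z + G z) (z - m) * W z) := by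
    have h1 : (fun z => inner ℝ (S z + G z) (z - m) * W z) =
        fun z => ∑ i, inner ℝ (S z + G z) (b i) * inner ℝ (b i) (z - m) * W z := by
      ext z
      rw [← b.sum_inner_mul_inner, Finset.sum_mul]
    rw [h1]
    exact integrable_finsetSum _ (fun i _ => Itr (b i))
  have Icm : ∀ c, Integrable (fun z => inner ℝ c (z - m) * W z) := fun c => 
    I1 _ _ (by fun_prop) (fun z => by
        have := gin (fun z => z - m) (1 + ‖m‖) hCm c z
        rwa [real_inner_comm] at this)
  have hT : (∫ z, ‖z - m‖ ^ 2 * W z) ≤ d / (κ - L) := by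
    rw [le_div_iff₀ (by linarith), mul_comm]
    have h1 : ∫ z, (κ - L) * (‖z - m‖ ^ 2 * W z) ≤
        ∫ z, (inner ℝ (S m + G m) (z - m) * W z - inner ℝ (S z + G z) (z - m) * W z) := by
      refine integral_mono (Imm.const_mul _) ((Icm _).sub I5) fun z => ?_
      simp only
      rw [← sub_mul, ← inner_sub_left, ← mul_assoc]
      refine mul_le_mul_of_nonneg_right ?_ (hWpos z).le
      have h2 : S m + G m - (S z + G z) = κ • (z - m) - (G z - G m) := by
        simp only [hS, smul_sub]; abel
      rw [h2, inner_sub_left, inner_smul_left, real_inner_self_eq_norm_sq]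
      have h3 := real_inner_le_norm (G z - G m) (z - m)
      have h4 := mul_le_mul_of_nonneg_right (hlip z m) (norm_nonneg (z - m))
      simp only [conj_trivial]
      nlinarith
    rw [integral_const_mul, integral_sub (Icm _) I5, hm0, E5] at h1
    linarith
  -- variance
  have hVar : ∀ w, ‖w‖ = 1 → (∫ z, (inner ℝ (G z) w - ∫ y, inner ℝ (G y) w * W y) ^ 2 * W z)
      ≤ L ^ 2 * (d / (κ - L)) := by
    intro w hw
    set e := ∫ y, inner ℝ (G y) w * W y with he
    have h1 : ∀ c : ℝ, ∫ z, (inner ℝ (G z) w - c) ^ 2 * W z =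
        (∫ z, inner ℝ (G z) w * inner ℝ (G z) w * W z) - 2 * c * e + c ^ 2 := by
      intro c
      have h2 : (fun z => (inner ℝ (G z) w - c) ^ 2 * W z) = fun z =>
        (inner ℝ (G z) w * inner ℝ (G z) w * W z - 2 * c * (inner ℝ (G z) w * W z)) + c ^ 2 * W z := by
        ext z; ring
      rw [h2, integral_add, integral_sub, integral_const_mul, integral_const_mul, hW1, mul_one]
      · exact Igg w w
      · exact (Ig w).const_mul _
      · exact (Igg w w).sub ((Ig w).const_mul _)
      · exact hW0.const_mul _
    have h3 : ∫ z, (inner ℝ (G z) w - inner ℝ (G m) w) ^ 2 * W z ≤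
        ∫ z, L ^ 2 * (‖z - m‖ ^ 2 * W z) := by
      refine integral_mono_of_nonneg (Eventually.of_forall fun z =>
        mul_nonneg (sq_nonneg _) (hWpos z).le) (Imm.const_mul _) (Eventually.of_forall fun z => ?_)
      simp only
      rw [← mul_assoc, ← inner_sub_left]
      refine mul_le_mul_of_nonneg_right ?_ (hWpos z).le
      rw [← mul_pow, ← sq_abs]
      refine pow_le_pow_left₀ (abs_nonneg _) ?_ 2
      refine (abs_real_inner_le_norm _ _).trans ?_
      rw [hw, mul_one]
      exact hlip z m
    rw [integral_const_mul] at h3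
    have h4 := mul_le_mul_of_nonneg_left hT (sq_nonneg L)
    rw [h1] at h3 ⊢
    nlinarith [sq_nonneg (inner ℝ (G m) w - e)]
  -- final
  set eu := ∫ y, inner ℝ (G y) u * W y with heu
  set ev := ∫ y, inner ℝ (G y) v * W y with hev
  have hcov : (∫ z, inner ℝ (G z) u * inner ℝ (G z) v * W z) - eu * ev =
      ∫ z, (inner ℝ (G z) u - eu) * (inner ℝ (G z) v - ev) * W z := by
    have h2 : (fun z => (inner ℝ (G z) u - eu) * (inner ℝ (G z) v - ev) * W z) = fun z =>
        ((inner ℝ (G z) u * inner ℝ (G z) v * W z - ev * (inner ℝ (G z) u * W z)) -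
          eu * (inner ℝ (G z) v * W z)) + eu * ev * W z := by
      ext z; ring
    rw [h2, integral_add, integral_sub, integral_sub, integral_const_mul, integral_const_mul,
      integral_const_mul, hW1, ← heu, ← hev]
    · ring
    · exact Igg u v
    · exact (Ig u).const_mul _
    · exact (Igg u v).sub ((Ig u).const_mul _)
    · exact (Ig v).const_mul _
    · exact ((Igg u v).sub ((Ig u).const_mul _)).sub ((Ig v).const_mul _)
    · exact hW0.const_mul _
  have Ivar : ∀ w (c : ℝ), Integrable (fun z => (inner ℝ (G z) w - c) ^ 2 * W z) := by
    intro w c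
    have h2 : (fun z => (inner ℝ (G z) w - c) ^ 2 * W z) = fun z =>
        (inner ℝ (G z) w * inner ℝ (G z) w * W z - 2 * c * (inner ℝ (G z) w * W z)) + c ^ 2 * W z := by
      ext z; ring
    rw [h2]
    exact ((Igg w w).sub ((Ig w).const_mul _)).add (hW0.const_mul _)
  have hcovb : |∫ z, (inner ℝ (G z) u - eu) * (inner ℝ (G z) v - ev) * W z| ≤
      L ^ 2 * (d / (κ - L)) := by
    have h1 : ‖∫ z, (inner ℝ (G z) u - eu) * (inner ℝ (G z) v - ev) * W z‖ ≤
        ∫ z, (1 / 2 * ((inner ℝ (G z) u - eu) ^ 2 * W z) +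
          1 / 2 * ((inner ℝ (G z) v - ev) ^ 2 * W z)) := by
      refine norm_integral_le_of_norm_le (((Ivar u eu).const_mul _).add ((Ivar v ev).const_mul _))
        (Eventually.of_forall fun z => ?_)
      rw [norm_mul, Real.norm_eq_abs, Real.norm_eq_abs, abs_of_pos (hWpos z), abs_mul]
      have h5 := sq_abs (inner ℝ (G z) u - eu)
      have h6 := sq_abs (inner ℝ (G z) v - ev)
      have h7 := mul_nonneg (sq_nonneg (|inner ℝ (G z) u - eu| - |inner ℝ (G z) v - ev|)) (hWpos z).le
      rw [← h5, ← h6]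
      nlinarith
    rw [integral_add ((Ivar u eu).const_mul _) ((Ivar v ev).const_mul _), integral_const_mul,
      integral_const_mul] at h1
    have h2 := hVar u hu
    have h3 := hVar v hv
    rw [← heu] at h2
    rw [← hev] at h3
    rw [Real.norm_eq_abs] at h1
    linarith
  have hHess : |∫ z, inner ℝ (fderiv ℝ G z u) v * W z| ≤ L := by
    have h1 : ‖∫ z, inner ℝ (fderiv ℝ G z u) v * W z‖ ≤ ∫ z, L * W z := by
      refine norm_integral_le_of_norm_le (hW0.const_mul _) (Eventually.of_forall fun z => ?_)
      rw [norm_mul, Real.norm_eq_abs, Real.norm_eq_abs, abs_of_pos (hWpos z)]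
      exact mul_le_mul_of_nonneg_right (hbd z) (hWpos z).le
    rwa [integral_const_mul, hW1, mul_one] at h1
  have hfin : (∫ z, inner ℝ (S z) u * inner ℝ (S z) v * W z) - κ * inner ℝ u v
      - (∫ z, inner ℝ (S z) u * W z) * (∫ z, inner ℝ (S z) v * W z) =
      (∫ z, inner ℝ (fderiv ℝ G z u) v * W z) +
      ∫ z, (inner ℝ (G z) u - eu) * (inner ℝ (G z) v - ev) * W z := by
    rw [← hcov, E1, E1, E2, E3]; ring
  rw [hfin]
  exact (abs_add_le _ _).trans (add_le_add hHess hcovb)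
end core
section kernel
variable {d : ℕ} {t : ℝ}

lemma heatKernel_pos (ht : 0 < t) (x z : EuclideanSpace ℝ (Fin d)) : 0 < heatKernel d t x z := by
  unfold heatKernel
  have : 0 < 2 * π * t := by positivity
  exact mul_pos (Real.rpow_pos_of_pos this _) (Real.exp_pos _)

lemma heatKernel_continuous_right (x : EuclideanSpace ℝ (Fin d)) :
    Continuous (fun z => heatKernel d t x z) := by
  unfold heatKernel
  fun_prop

lemma heatKernel_hasFDerivAt_left (ht : 0 < t) (x z : EuclideanSpace ℝ (Fin d)) :
    HasFDerivAt (fun y => heatKernel d t y z)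
      (heatKernel d t x z • ((-(1 / t)) • innerSL ℝ (x - Real.sqrt (1 - t) • z))) x := by
  unfold heatKernel
  have h1 : HasFDerivAt (fun y : EuclideanSpace ℝ (Fin d) => y - Real.sqrt (1 - t) • z)
    (ContinuousLinearMap.id ℝ _) x := (hasFDerivAt_id x).sub_const _
  have h2 := ((h1.norm_sq.const_mul (-(1 / (2 * t)))).exp).const_mul
    ((2 * π * t) ^ (-(d : ℝ) / 2))
  convert! h2 using 1
  · ext y; congr 2; ring
  · ext w
    simp only [smul_apply, innerSL_apply_apply, smul_eq_mul, ContinuousLinearMap.comp_apply,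
      ContinuousLinearMap.id_apply]
    have h3 : -‖x - Real.sqrt (1 - t) • z‖ ^ 2 / (2 * t)
      = -(1 / (2 * t)) * ‖x - Real.sqrt (1 - t) • z‖ ^ 2 := by ring
    rw [h3]
    field_simp
    simp
    try ring

lemma heatKernel_hasFDerivAt_right (ht : 0 < t) (x z : EuclideanSpace ℝ (Fin d)) :
    HasFDerivAt (fun y => heatKernel d t x y)
      (heatKernel d t x z • innerSL ℝ ((Real.sqrt (1 - t) / t) • (x - Real.sqrt (1 - t) • z))) z := by
  unfold heatKernel
  have h1 : HasFDerivAt (fun y : EuclideanSpace ℝ (Fin d) => x - Real.sqrt (1 - t) • y)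
    (-(Real.sqrt (1 - t) • ContinuousLinearMap.id ℝ _)) z := by
    have h0 : HasFDerivAt (fun y : EuclideanSpace ℝ (Fin d) => Real.sqrt (1 - t) • y)
      (Real.sqrt (1 - t) • ContinuousLinearMap.id ℝ _) z :=
      (Real.sqrt (1 - t) • ContinuousLinearMap.id ℝ (EuclideanSpace ℝ (Fin d))).hasFDerivAt
    exact h0.const_sub x
  have h2 := ((h1.norm_sq.const_mul (-(1 / (2 * t)))).exp).const_mul
    ((2 * π * t) ^ (-(d : ℝ) / 2))
  convert! h2 using 1
  · ext y; congr 2; ring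
  · ext w
    simp only [smul_apply, innerSL_apply_apply, smul_eq_mul, ContinuousLinearMap.comp_apply,
      ContinuousLinearMap.id_apply, neg_apply, inner_neg_right,
      inner_smul_right, inner_smul_left, conj_trivial]
    have h3 : -‖x - Real.sqrt (1 - t) • z‖ ^ 2 / (2 * t)
      = -(1 / (2 * t)) * ‖x - Real.sqrt (1 - t) • z‖ ^ 2 := by ring
    rw [h3]
    simp [inner_smul_right]
    field_simp

/-- A uniform bound for `(1 + r²) * heatKernel`. -/
lemma heatKernel_bound (ht : 0 < t) : ∃ C, 0 ≤ C ∧ ∀ x z : EuclideanSpace ℝ (Fin d),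
    (1 + ‖x - Real.sqrt (1 - t) • z‖ ^ 2) * heatKernel d t x z ≤ C := by
  have hc : 0 < (2 * π * t) ^ (-(d : ℝ) / 2) := Real.rpow_pos_of_pos (by positivity) _
  refine ⟨(2 * π * t) ^ (-(d : ℝ) / 2) * (1 + 2 * t), by positivity, fun x z => ?_⟩
  unfold heatKernel
  set r := ‖x - Real.sqrt (1 - t) • z‖ ^ 2 with hr
  have hr0 : 0 ≤ r := by positivity
  have h1 : (1 + r) ≤ (1 + 2 * t) * Real.exp (r / (2 * t)) := by
    have h2 := Real.add_one_le_exp (r / (2 * t))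
    have h3 : r / (2 * t) * (2 * t) = r := by field_simp
    have h4 : 0 ≤ r / (2 * t) := by positivity
    nlinarith
  have h5 : (1 + r) * Real.exp (-r / (2 * t)) ≤ 1 + 2 * t := by
    rw [neg_div, Real.exp_neg, ← div_eq_mul_inv, div_le_iff₀ (Real.exp_pos _)]
    exact h1
  nlinarith

end kernel

section final
variable {d : ℕ} {t : ℝ}

lemma aux_D1 (ht : 0 < t) (ρ₀ : EuclideanSpace ℝ (Fin d) → ℝ) (hpos : ∀ x, 0 < ρ₀ x)
    (hc : Continuous ρ₀) (hi : Integrable ρ₀) (x : EuclideanSpace ℝ (Fin d)) :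
    Integrable (fun z => (ρ₀ z * heatKernel d t x z) •
        ((-(1 / t)) • innerSL ℝ (x - Real.sqrt (1 - t) • z))) ∧
    HasFDerivAt (fun y => ∫ z, ρ₀ z * heatKernel d t y z)
      (∫ z, (ρ₀ z * heatKernel d t x z) •
        ((-(1 / t)) • innerSL ℝ (x - Real.sqrt (1 - t) • z))) x := by
  obtain ⟨C, hC0, hC⟩ := heatKernel_bound (d := d) ht
  have hkc := fun y => heatKernel_continuous_right (d := d) (t := t) y
  have hkc' := hkc x
  have hb : ∀ y z, ‖(ρ₀ z * heatKernel d t y z) •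
        ((-(1 / t)) • innerSL ℝ (y - Real.sqrt (1 - t) • z))‖ ≤ 1 / t * C * ρ₀ z := by
    intro y z
    have hk := heatKernel_pos ht y z
    rw [norm_smul, norm_smul, innerSL_apply_norm, Real.norm_eq_abs, Real.norm_eq_abs,
      abs_of_pos (mul_pos (hpos z) hk), abs_neg, abs_of_pos (by positivity)]
    have h1 : heatKernel d t y z * ‖y - Real.sqrt (1 - t) • z‖ ≤ C := by
      refine le_trans ?_ (hC y z)
      rw [mul_comm]
      refine mul_le_mul_of_nonneg_right ?_ hk.le
      nlinarith [sq_nonneg (‖y - Real.sqrt (1 - t) • z‖ - 1)]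
    have h2 : 0 ≤ 1 / t * ρ₀ z := mul_nonneg (by positivity) (hpos z).le
    nlinarith [mul_le_mul_of_nonneg_left h1 h2]
  have hmeas : Continuous (fun z => (ρ₀ z * heatKernel d t x z) •
        ((-(1 / t)) • innerSL ℝ (x - Real.sqrt (1 - t) • z))) := by fun_prop
  refine ⟨Integrable.mono' (hi.const_mul _) hmeas.aestronglyMeasurable
    (Eventually.of_forall (hb x)), ?_⟩
  refine hasFDerivAt_integral_of_dominated_of_fderiv_le (s := Set.univ)
    (F' := fun y z => (ρ₀ z * heatKernel d t y z) •
        ((-(1 / t)) • innerSL ℝ (y - Real.sqrt (1 - t) • z)))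
    (bound := fun z => 1 / t * C * ρ₀ z) univ_mem
    (Eventually.of_forall fun y => (hc.mul (hkc y)).aestronglyMeasurable)
    (Integrable.mono' (hi.const_mul C) (hc.mul (hkc x)).aestronglyMeasurable
      (Eventually.of_forall fun z => ?_)) hmeas.aestronglyMeasurable
    (Eventually.of_forall fun z y _ => hb y z) (hi.const_mul _)
    (Eventually.of_forall fun z y _ => ?_)
  · have hk := heatKernel_pos ht x z
    rw [Real.norm_eq_abs, abs_of_pos (mul_pos (hpos z) hk), mul_comm]
    refine mul_le_mul_of_nonneg_right ?_ (hpos z).le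
    have := hC x z
    nlinarith [mul_nonneg (sq_nonneg ‖x - Real.sqrt (1 - t) • z‖) hk.le]
  · have := (heatKernel_hasFDerivAt_left ht y z).const_mul (ρ₀ z)
    rw [smul_smul] at this
    exact this

lemma aux_D2 (ht : 0 < t) (ρ₀ : EuclideanSpace ℝ (Fin d) → ℝ) (hpos : ∀ x, 0 < ρ₀ x)
    (hc : Continuous ρ₀) (hi : Integrable ρ₀) (x v : EuclideanSpace ℝ (Fin d)) :
    Integrable (fun z => ρ₀ z • (inner ℝ (x - Real.sqrt (1 - t) • z) v • (heatKernel d t x z •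
        ((-(1 / t)) • innerSL ℝ (x - Real.sqrt (1 - t) • z))) + heatKernel d t x z • innerSL ℝ v)) ∧
    HasFDerivAt (fun y => ∫ z, ρ₀ z * (inner ℝ (y - Real.sqrt (1 - t) • z) v * heatKernel d t y z))
      (∫ z, ρ₀ z • (inner ℝ (x - Real.sqrt (1 - t) • z) v • (heatKernel d t x z •
        ((-(1 / t)) • innerSL ℝ (x - Real.sqrt (1 - t) • z))) +
        heatKernel d t x z • innerSL ℝ v)) x := by
  obtain ⟨C, hC0, hC⟩ := heatKernel_bound (d := d) ht
  have hkc := fun y => heatKernel_continuous_right (d := d) (t := t) y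
  have hkc' := hkc x
  have hC1 : ∀ y z : EuclideanSpace ℝ (Fin d), heatKernel d t y z ≤ C := fun y z => by
    have hk := heatKernel_pos ht y z
    nlinarith [hC y z, mul_nonneg (sq_nonneg ‖y - Real.sqrt (1 - t) • z‖) hk.le]
  have hC2 : ∀ y z : EuclideanSpace ℝ (Fin d),
      ‖y - Real.sqrt (1 - t) • z‖ ^ 2 * heatKernel d t y z ≤ C := fun y z => by
    have hk := heatKernel_pos ht y z
    nlinarith [hC y z]
  have hC3 : ∀ y z : EuclideanSpace ℝ (Fin d),
      ‖y - Real.sqrt (1 - t) • z‖ * heatKernel d t y z ≤ C := fun y z => by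
    have hk := heatKernel_pos ht y z
    refine le_trans ?_ (hC y z)
    refine mul_le_mul_of_nonneg_right ?_ hk.le
    nlinarith [sq_nonneg (‖y - Real.sqrt (1 - t) • z‖ - 1)]
  have hb : ∀ y z, ‖ρ₀ z • (inner ℝ (y - Real.sqrt (1 - t) • z) v • (heatKernel d t y z •
        ((-(1 / t)) • innerSL ℝ (y - Real.sqrt (1 - t) • z))) +
        heatKernel d t y z • innerSL ℝ v)‖ ≤ (‖v‖ / t * C + ‖v‖ * C) * ρ₀ z := by
    intro y z
    have hk := heatKernel_pos ht y z
    rw [norm_smul, Real.norm_eq_abs, abs_of_pos (hpos z), mul_comm]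
    refine mul_le_mul_of_nonneg_right ?_ (hpos z).le
    refine (norm_add_le _ _).trans ?_
    rw [norm_smul, norm_smul, norm_smul, norm_smul, innerSL_apply_norm, innerSL_apply_norm,
      Real.norm_eq_abs, Real.norm_eq_abs, Real.norm_eq_abs,
      abs_of_pos hk, abs_neg, abs_of_pos (by positivity : 0 < 1 / t)]
    refine add_le_add ?_ ?_
    · have h1 := abs_real_inner_le_norm (y - Real.sqrt (1 - t) • z) v
      calc _ ≤ (‖y - Real.sqrt (1 - t) • z‖ * ‖v‖) *
            (heatKernel d t y z * (1 / t * ‖y - Real.sqrt (1 - t) • z‖)) :=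
            mul_le_mul_of_nonneg_right h1 (by positivity)
        _ = ‖v‖ / t * (‖y - Real.sqrt (1 - t) • z‖ ^ 2 * heatKernel d t y z) := by ring
        _ ≤ _ := mul_le_mul_of_nonneg_left (hC2 y z) (by positivity)
    · rw [mul_comm]
      exact mul_le_mul_of_nonneg_left (hC1 y z) (norm_nonneg v)
  have hmeas : Continuous (fun z => ρ₀ z • (inner ℝ (x - Real.sqrt (1 - t) • z) v •
      (heatKernel d t x z • ((-(1 / t)) • innerSL ℝ (x - Real.sqrt (1 - t) • z))) +
        heatKernel d t x z • innerSL ℝ v)) := by fun_prop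
  refine ⟨Integrable.mono' (hi.const_mul _) hmeas.aestronglyMeasurable
    (Eventually.of_forall (hb x)), ?_⟩
  have hm0 : ∀ y, Continuous (fun z => ρ₀ z *
      (inner ℝ (y - Real.sqrt (1 - t) • z) v * heatKernel d t y z)) := fun y => by
    have := hkc y
    fun_prop
  refine hasFDerivAt_integral_of_dominated_of_fderiv_le (s := Set.univ)
    (F' := fun y z => ρ₀ z • (inner ℝ (y - Real.sqrt (1 - t) • z) v • (heatKernel d t y z •
        ((-(1 / t)) • innerSL ℝ (y - Real.sqrt (1 - t) • z))) +
        heatKernel d t y z • innerSL ℝ v))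
    (bound := fun z => (‖v‖ / t * C + ‖v‖ * C) * ρ₀ z) univ_mem
    (Eventually.of_forall fun y => (hm0 y).aestronglyMeasurable)
    (Integrable.mono' (hi.const_mul (‖v‖ * C)) (hm0 x).aestronglyMeasurable
      (Eventually.of_forall fun z => ?_)) hmeas.aestronglyMeasurable
    (Eventually.of_forall fun z y _ => hb y z) (hi.const_mul _)
    (Eventually.of_forall fun z y _ => ?_)
  · have hk := heatKernel_pos ht x z
    rw [norm_mul, norm_mul, Real.norm_eq_abs, Real.norm_eq_abs, Real.norm_eq_abs,
      abs_of_pos (hpos z), abs_of_pos hk, mul_comm]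
    refine mul_le_mul_of_nonneg_right ?_ (hpos z).le
    have h1 := abs_real_inner_le_norm (x - Real.sqrt (1 - t) • z) v
    nlinarith [mul_le_mul_of_nonneg_right h1 hk.le,
      mul_le_mul_of_nonneg_left (hC3 x z) (norm_nonneg v)]
  · have h1 : HasFDerivAt (fun y => inner ℝ (y - Real.sqrt (1 - t) • z) v) (innerSL ℝ v) y := by
      have h1 := ((innerSL ℝ v).hasFDerivAt (x := y)).sub_const
        (inner ℝ v (Real.sqrt (1 - t) • z))
      convert! h1 using 1
      ext y
      rw [real_inner_comm, inner_sub_right]; rfl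
    exact (h1.mul (heatKernel_hasFDerivAt_left ht y z)).const_mul (ρ₀ z)

end final


set_option maxHeartbeats 2000000 in
/-- **Claim (smoothness of `log ρ_t` for small `t`).** If `X₀` has a smooth density `ρ₀` with
`L := sup_x ‖∇² log ρ₀(x)‖ < ∞` (operator norm), then for every
`t ∈ (0, min{1/2, 1/(2(L+1)), 1/(2Ld)}]` one has `sup_x ‖∇² log ρ_t(x)‖ ≤ 4L`. -/
theorem hessian_log_density_bound_small_time
    (d : ℕ) (hd : 1 ≤ d) (μ : Measure (EuclideanSpace ℝ (Fin d))) [IsProbabilityMeasure μ]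
    (ρ₀ : EuclideanSpace ℝ (Fin d) → ℝ)
    (hdensity : μ = volume.withDensity (fun x => ENNReal.ofReal (ρ₀ x)))
    (hpos : ∀ x, 0 < ρ₀ x) (hsmooth : ContDiff ℝ (⊤ : ℕ∞) ρ₀)
    (L : ℝ) (hL : ∀ x, ‖fderiv ℝ (gradient (fun y => Real.log (ρ₀ y))) x‖ ≤ L)
    (t : ℝ) (ht₀ : 0 < t)
    (ht : t ≤ min (1 / 2) (min (1 / (2 * (L + 1))) (1 / (2 * L * d))))
    (x : EuclideanSpace ℝ (Fin d)) :
    ‖fderiv ℝ (gradient (fun y => Real.log (rho d μ t y))) x‖ ≤ 4 * L := by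
  obtain ⟨ht1, ht2, ht3⟩ : t ≤ 1 / 2 ∧ t ≤ 1 / (2 * (L + 1)) ∧ t ≤ 1 / (2 * L * d) := by
    simpa [le_min_iff] using ht
  have hL0 : 0 ≤ L := (norm_nonneg _).trans (hL 0)
  have hLpos : 0 < L := by
    rcases hL0.eq_or_lt with h | h
    · rw [← h] at ht3
      simp at ht3
      linarith
    · exact h
  have hdpos : (0 : ℝ) < d := by exact_mod_cast hd
  have ht2' : t * (L + 1) ≤ 1 / 2 := by
    rw [le_div_iff₀ (by positivity)] at ht2
    linarith
  have ht3' : t * (L * d) ≤ 1 / 2 := by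
    rw [le_div_iff₀ (by positivity)] at ht3
    linarith
  have hc : Continuous ρ₀ := hsmooth.continuous
  have hi : Integrable ρ₀ := by
    refine ⟨hc.aestronglyMeasurable, ?_⟩
    rw [hasFiniteIntegral_iff_ofReal (Eventually.of_forall fun z => (hpos z).le)]
    have h1 : μ Set.univ = 1 := measure_univ
    rw [hdensity, withDensity_apply _ MeasurableSet.univ, Measure.restrict_univ] at h1
    rw [h1]; exact ENNReal.one_lt_top
  set a := Real.sqrt (1 - t) with ha
  have ha2 : a ^ 2 = 1 - t := Real.sq_sqrt (by linarith)
  have hapos : 0 < a := Real.sqrt_pos.2 (by linarith)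
  set r : EuclideanSpace ℝ (Fin d) → ℝ := fun y => ∫ z, ρ₀ z * heatKernel d t y z with hr
  have hrho : ∀ y, rho d μ t y = r y := by
    intro y
    rw [rho, hdensity, integral_withDensity_eq_integral_toReal_smul
      (by have := hc.measurable; fun_prop) (Eventually.of_forall fun z => ENNReal.ofReal_lt_top)]
    simp only [hr]
    congr 1; ext z
    rw [ENNReal.toReal_ofReal (hpos z).le, smul_eq_mul]
  have hD1 := fun y => aux_D1 ht₀ ρ₀ hpos hc hi y
  have hkc := fun y => heatKernel_continuous_right (d := d) (t := t) y
  obtain ⟨C, hC0, hC⟩ := heatKernel_bound (d := d) ht₀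
  have hkpos := fun y z => heatKernel_pos (d := d) ht₀ y z
  have hwi : ∀ y, Integrable (fun z => ρ₀ z * heatKernel d t y z) := fun y => by
    refine Integrable.mono' (hi.const_mul C) (hc.mul (hkc y)).aestronglyMeasurable
      (Eventually.of_forall fun z => ?_)
    have hk := hkpos y z
    rw [Real.norm_eq_abs, abs_of_pos (mul_pos (hpos z) hk), mul_comm]
    refine mul_le_mul_of_nonneg_right ?_ (hpos z).le
    have := hC y z
    nlinarith [mul_nonneg (sq_nonneg ‖y - Real.sqrt (1 - t) • z‖) hk.le]
  have hwi2 : Integrable (fun z => ‖z‖ ^ 2 * (ρ₀ z * heatKernel d t x z)) := by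
    have hkx := hkc x
    refine Integrable.mono' (hi.const_mul (2 * (‖x‖ ^ 2 + 1) / a ^ 2 * C))
      (by fun_prop) (Eventually.of_forall fun z => ?_)
    have hk := hkpos x z
    rw [Real.norm_eq_abs, abs_of_nonneg (mul_nonneg (sq_nonneg _) (mul_pos (hpos z) hk).le)]
    have h1 : ‖z‖ ^ 2 ≤ 2 * (‖x‖ ^ 2 + 1) / a ^ 2 * (1 + ‖x - a • z‖ ^ 2) := by
      rw [div_mul_eq_mul_div, le_div_iff₀ (by positivity)]
      have h2 : a * ‖z‖ ≤ ‖x‖ + ‖x - a • z‖ := by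
        have h3 : a • z = x - (x - a • z) := by abel
        have h4 : ‖a • z‖ = a * ‖z‖ := by rw [norm_smul, Real.norm_eq_abs, abs_of_pos hapos]
        rw [← h4]
        conv_lhs => rw [h3]
        exact norm_sub_le _ _
      have h5 : (a * ‖z‖) ^ 2 ≤ (‖x‖ + ‖x - a • z‖) ^ 2 :=
        pow_le_pow_left₀ (by positivity) h2 2
      nlinarith [sq_nonneg (‖x‖ - ‖x - a • z‖), mul_nonneg (sq_nonneg ‖x‖) (sq_nonneg ‖x - a • z‖)]
    calc ‖z‖ ^ 2 * (ρ₀ z * heatKernel d t x z)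
        ≤ (2 * (‖x‖ ^ 2 + 1) / a ^ 2 * (1 + ‖x - a • z‖ ^ 2)) * (ρ₀ z * heatKernel d t x z) :=
          mul_le_mul_of_nonneg_right h1 (mul_pos (hpos z) hk).le
      _ = 2 * (‖x‖ ^ 2 + 1) / a ^ 2 * ((1 + ‖x - a • z‖ ^ 2) * heatKernel d t x z) * ρ₀ z := by ring
      _ ≤ _ := by
          refine mul_le_mul_of_nonneg_right ?_ (hpos z).le
          exact mul_le_mul_of_nonneg_left (hC x z) (by positivity)
  have hrpos : ∀ y, 0 < r y := fun y => by
    rw [hr]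
    refine (integral_pos_iff_support_of_nonneg (fun z => (mul_pos (hpos z) (hkpos y z)).le)
      (hwi y)).2 ?_
    have : Function.support (fun z => ρ₀ z * heatKernel d t y z) = Set.univ := by
      ext z; simp [(mul_pos (hpos z) (hkpos y z)).ne', (hpos z).ne', (hkpos y z).ne']
    rw [this]
    exact Measure.measure_univ_pos.2 (NeZero.ne _)
  set n : EuclideanSpace ℝ (Fin d) → EuclideanSpace ℝ (Fin d) → ℝ := fun v y =>
    ∫ z, ρ₀ z * (inner ℝ (y - a • z) v * heatKernel d t y z) with hn
  -- first derivative of `r`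
  have hrd : ∀ y, ∃ r' : EuclideanSpace ℝ (Fin d) →L[ℝ] ℝ, HasFDerivAt r r' y ∧
      ∀ v, r' v = -(1 / t) * n v y := by
    intro y
    refine ⟨_, (hD1 y).2, fun v => ?_⟩
    rw [ContinuousLinearMap.integral_apply (hD1 y).1, hn, ← integral_const_mul]
    congr 1; ext z
    simp only [smul_apply, innerSL_apply_apply, smul_eq_mul]
    ring
  have hgrad : ∀ v y, inner ℝ (gradient (fun y => Real.log (rho d μ t y)) y) v =
      -(1 / t) * (n v y / r y) := by
    intro v y
    obtain ⟨r', h1, h2⟩ := hrd y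
    have h3 : HasFDerivAt (fun y => Real.log (rho d μ t y)) ((r y)⁻¹ • r') y := by
      simp only [hrho]
      exact h1.log (hrpos y).ne'
    have h4 : inner ℝ (gradient (fun y => Real.log (rho d μ t y)) y) v =
        fderiv ℝ (fun y => Real.log (rho d μ t y)) y v := by
      rw [← toDual_gradient]; simp
    rw [h4, h3.fderiv, smul_apply, h2, smul_eq_mul]
    ring
  by_cases hdiff : DifferentiableAt ℝ (gradient (fun y => Real.log (rho d μ t y))) x
  swap
  · rw [fderiv_zero_of_not_differentiableAt hdiff, norm_zero]; positivity
  refine ContinuousLinearMap.opNorm_le_of_re_inner_le (by positivity) fun u v hu hv => ?_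
  simp only [RCLike.re_to_real]
  -- the Hessian as covariance
  set M := ∫ z, ρ₀ z * (inner ℝ (x - a • z) u * inner ℝ (x - a • z) v * heatKernel d t x z) with hM
  have hMi : Integrable (fun z => ρ₀ z * (inner ℝ (x - a • z) u * inner ℝ (x - a • z) v *
      heatKernel d t x z)) := by
    have hkx := hkc x
    refine Integrable.mono' (hi.const_mul C) (by fun_prop) (Eventually.of_forall fun z => ?_)
    have hk := hkpos x z
    rw [norm_mul, norm_mul, norm_mul, Real.norm_eq_abs, Real.norm_eq_abs, Real.norm_eq_abs,
      Real.norm_eq_abs, abs_of_pos (hpos z), abs_of_pos hk, mul_comm]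
    refine mul_le_mul_of_nonneg_right ?_ (hpos z).le
    refine le_trans ?_ (hC x z)
    refine mul_le_mul_of_nonneg_right ?_ hk.le
    have h1 := abs_real_inner_le_norm (x - a • z) u
    have h2 := abs_real_inner_le_norm (x - a • z) v
    rw [hu, mul_one] at h1
    rw [hv, mul_one] at h2
    have := mul_le_mul h1 h2 (abs_nonneg _) (norm_nonneg _)
    change _ ≤ 1 + ‖x - a • z‖ ^ 2
    nlinarith
  have hHess : inner ℝ (fderiv ℝ (gradient (fun y => Real.log (rho d μ t y))) x u) v =
      -(1 / t) * inner ℝ u v + 1 / t ^ 2 * (M / r x - n u x / r x * (n v x / r x)) := by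
    obtain ⟨r', h1, h2⟩ := hrd x
    obtain ⟨hi2, hd2⟩ := aux_D2 ht₀ ρ₀ hpos hc hi x v
    have hn' := ContinuousLinearMap.integral_apply hi2 u
    have h5 : HasFDerivAt (fun y => inner ℝ (gradient (fun y => Real.log (rho d μ t y)) y) v)
        ((innerSL ℝ v).comp (fderiv ℝ (gradient (fun y => Real.log (rho d μ t y))) x)) x := by
      have h1 := ((innerSL ℝ v).hasFDerivAt
        (x := gradient (fun y => Real.log (rho d μ t y)) x)).comp x hdiff.hasFDerivAt
      convert! h1 using 1
      ext z
      simp [real_inner_comm]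
    simp only [hgrad] at h5
    have hinv : HasFDerivAt (fun y => (r y)⁻¹) ((-(r x ^ 2)⁻¹) • r') x :=
      (hasDerivAt_inv (hrpos x).ne').comp_hasFDerivAt x h1
    have h6 := (hd2.mul hinv).const_mul (-(1 / t))
    simp only [div_eq_mul_inv (n v _)] at h5
    have h7 := congrArg (fun T => T u) (h5.unique h6)
    simp only [ContinuousLinearMap.comp_apply, innerSL_apply_apply, smul_apply, add_apply,
      smul_eq_mul] at h7
    rw [real_inner_comm, h7, hn', h2]
    have h8 : ∫ z, (ρ₀ z • (inner ℝ (x - a • z) v • (heatKernel d t x z •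
        ((-(1 / t)) • innerSL ℝ (x - a • z))) +
        heatKernel d t x z • innerSL ℝ v)) u = -(1 / t) * M + inner ℝ u v * r x := by
      have h9 : (fun z => (ρ₀ z • (inner ℝ (x - a • z) v • (heatKernel d t x z •
        ((-(1 / t)) • innerSL ℝ (x - a • z))) +
        heatKernel d t x z • innerSL ℝ v)) u) = fun z =>
          -(1 / t) * (ρ₀ z * (inner ℝ (x - a • z) u * inner ℝ (x - a • z) v * heatKernel d t x z))
          + inner ℝ u v * (ρ₀ z * heatKernel d t x z) := by
        ext z
        simp only [smul_apply, add_apply, innerSL_apply_apply, smul_eq_mul]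
        rw [real_inner_comm u v]
        ring
      rw [h9, integral_add (hMi.const_mul _) ((hwi x).const_mul _), integral_const_mul,
        integral_const_mul]
    rw [h8]
    have h10 : ∫ z, ρ₀ z * (inner ℝ (x - a • z) v * heatKernel d t x z) = n v x := rfl
    rw [h10]
    have hrx := (hrpos x).ne'
    field_simp
    ring
  -- apply the core estimate
  set G := gradient (fun y => Real.log (ρ₀ y)) with hGdef
  have hlog : ContDiff ℝ (⊤ : ℕ∞) (fun y => Real.log (ρ₀ y)) := hsmooth.log fun y => (hpos y).ne'
  have hG : ContDiff ℝ 1 G := by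
    have h1 : ContDiff ℝ 1 (fderiv ℝ (fun y => Real.log (ρ₀ y))) :=
      hlog.fderiv_right (by norm_cast)
    exact (InnerProductSpace.toDual ℝ (EuclideanSpace ℝ (Fin d))).symm.contDiff.comp h1
  have hρd : ∀ z, HasFDerivAt ρ₀ (ρ₀ z • innerSL ℝ (G z)) z := by
    intro z
    have h1 : DifferentiableAt ℝ ρ₀ z := (hsmooth.differentiable (by simp)) z
    have h2 := (h1.hasFDerivAt.log (hpos z).ne').fderiv
    have h3 : innerSL ℝ (G z) = fderiv ℝ (fun y => Real.log (ρ₀ y)) z := by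
      rw [← toDual_gradient]; rfl
    rw [h3, h2, smul_smul, mul_inv_cancel₀ (hpos z).ne', one_smul]
    exact h1.hasFDerivAt
  have hκ : L < a ^ 2 / t := by
    rw [lt_div_iff₀ ht₀, ha2]; nlinarith
  have hcore := aux_core (fun z => (r x)⁻¹ * (ρ₀ z * heatKernel d t x z))
    (fun z => mul_pos (inv_pos.2 (hrpos x)) (mul_pos (hpos z) (hkpos x z)))
    (continuous_const.mul (hc.mul (hkc x))) ((hwi x).const_mul _)
    ((hwi2.const_mul (r x)⁻¹).congr (Eventually.of_forall fun z => by simp only; ring))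
    (by rw [integral_const_mul]; exact inv_mul_cancel₀ (hrpos x).ne')
    L (a ^ 2 / t) hκ ((a / t) • x) G hG hL
    (fun z => by
      have h1 := ((hρd z).mul (heatKernel_hasFDerivAt_right ht₀ x z)).const_mul (r x)⁻¹
      convert! h1 using 1
      ext w
      simp only [smul_apply, add_apply, innerSL_apply_apply, smul_eq_mul, inner_add_left,
        inner_sub_left, inner_smul_left, conj_trivial, ← ha]
      ring) u v hu hv
  have hSx : ∀ z w, inner ℝ ((a / t) • x - (a ^ 2 / t) • z) w = a / t * inner ℝ (x - a • z) w := by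
    intro z w
    simp only [inner_sub_left, inner_smul_left, conj_trivial]; ring
  have hA : ∫ z, inner ℝ ((a / t) • x - (a ^ 2 / t) • z) u *
      inner ℝ ((a / t) • x - (a ^ 2 / t) • z) v * ((r x)⁻¹ * (ρ₀ z * heatKernel d t x z)) =
      a ^ 2 / t ^ 2 * (M / r x) := by
    have h1 : a ^ 2 / t ^ 2 * (M / r x) = (a ^ 2 / t ^ 2 * (r x)⁻¹) * M := by ring
    rw [h1, hM, ← integral_const_mul]
    congr 1; ext z
    rw [hSx, hSx]; ring
  have hB : ∀ w, ∫ z, inner ℝ ((a / t) • x - (a ^ 2 / t) • z) w *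
      ((r x)⁻¹ * (ρ₀ z * heatKernel d t x z)) = a / t * (n w x / r x) := by
    intro w
    have h1 : a / t * (n w x / r x) = (a / t * (r x)⁻¹) * n w x := by ring
    rw [h1, hn, ← integral_const_mul]
    congr 1; ext z
    rw [hSx]; ring
  rw [hA, hB, hB] at hcore
  have hfac : a ^ 2 / t ^ 2 * (M / r x) - a ^ 2 / t * inner ℝ u v -
      a / t * (n u x / r x) * (a / t * (n v x / r x)) = a ^ 2 *
      inner ℝ (fderiv ℝ (gradient (fun y => Real.log (rho d μ t y))) x u) v := by
    rw [hHess]; ring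
  rw [hfac] at hcore
  have hq : L ^ 2 * (d / (a ^ 2 / t - L)) ≤ L := by
    have h1 : 0 < a ^ 2 / t - L := by linarith
    rw [← mul_div_assoc, div_le_iff₀ h1]
    have h2 : L * d ≤ a ^ 2 / t - L := by
      rw [le_sub_iff_add_le, le_div_iff₀ ht₀, ha2]; nlinarith
    nlinarith
  have hup := (le_abs_self _).trans hcore
  set H := inner ℝ (fderiv ℝ (gradient (fun y => Real.log (rho d μ t y))) x u) v
  rw [ha2] at hup
  have h2 : (1 - t) * H ≤ 2 * L := by rw [ha2] at hq; linarith
  by_contra! hcon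
  nlinarith
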